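/- arXiv:2407.18259 — 2 statements merged into one kernel-verified Lean document; each statement's English description precedes it below -/
import Mathlib

section
/- (Gabriel's convexity theorem) Let α < β be real numbers and let f be a function continuous on the closed strip {s ∈ ℂ : α ≤ Re(s) ≤ β}, analytic on the open strip α < Re(s) < β, and such that f(σ+it) → 0 uniformly in σ ∈ [α,β] as |t| → ∞. For λ > 0 define J(σ,λ) = (∫_{−∞}^{∞} |f(σ+it)|^{1/λ} dt)^{λ}. Then for all λ, μ > 0 and all σ with α < σ < β, setting p = (β−σ)/(β−α) and q = (σ−α)/(β−α), one has J(σ, pλ+qμ) ≤ J(α,λ)^p · J(β,μ)^q (provided the right-hand integrals are finite). -/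
open Complex MeasureTheory
open scoped ENNReal NNReal

open Metric Filter Set Topology

/-- Sub-mean value property of `‖g‖ ^ a` for analytic `g` and any exponent `a > 0`. -/
lemma AnalyticOnNhd.norm_rpow_le_circleAverage {g : ℂ → ℂ} {z : ℂ} {r a : ℝ} (hr : 0 < r)
    (ha : 0 < a) (hg : AnalyticOnNhd ℂ g (closedBall z r)) :
    ‖g z‖ ^ a ≤ Real.circleAverage (fun w ↦ ‖g w‖ ^ a) z r := by
  rcases eq_or_ne (g z) 0 with h0 | h0
  · rw [h0, norm_zero, Real.zero_rpow ha.ne']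
    exact Real.circleAverage_nonneg_of_nonneg fun _ _ ↦ by positivity
  have habs : |r| = r := abs_of_pos hr
  have hsphere : AnalyticOnNhd ℂ g (sphere z r) := hg.mono sphere_subset_closedBall
  have hlogint : CircleIntegrable (fun w ↦ Real.log ‖g w‖) z r :=
    MeromorphicOn.circleIntegrable_log_norm (by rw [habs]; exact hsphere.meromorphicOn)
  have hpowint : CircleIntegrable (fun w ↦ ‖g w‖ ^ a) z r :=
    ContinuousOn.circleIntegrable hr.le
      (hsphere.continuousOn.norm.rpow_const fun _ _ ↦ Or.inr ha.le)
  have hjensen : Real.log ‖g z‖ ≤ Real.circleAverage (fun w ↦ Real.log ‖g w‖) z r := by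
    rw [AnalyticOnNhd.circleAverage_log_norm hr.ne' (by rwa [habs]) h0, le_add_iff_nonneg_left]
    refine finsum_nonneg fun u ↦ ?_
    have hg' : AnalyticOnNhd ℂ g (closedBall z |r|) := by rwa [habs]
    by_cases hu : u ∈ closedBall z |r|
    · refine mul_nonneg (mod_cast MeromorphicOn.AnalyticOnNhd.divisor_nonneg hg' u) ?_
      rcases eq_or_ne z u with rfl | hzu
      · simp
      · have hpos : 0 < ‖z - u‖ := norm_pos_iff.mpr (sub_ne_zero.mpr hzu)
        refine Real.log_nonneg ?_
        rw [← div_eq_mul_inv, one_le_div hpos, ← dist_eq_norm, dist_comm]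
        rwa [habs, mem_closedBall] at hu
    · simp [Function.locallyFinsuppWithin.apply_eq_zero_of_notMem, hu]
  have hcod : ∀ᶠ w in codiscreteWithin (sphere z |r|), g w ≠ 0 := by
    rw [habs]
    refine codiscreteWithin_mono sphere_subset_closedBall
      (hg.preimage_zero_mem_codiscreteWithin h0 (mem_closedBall_self hr.le) ?_)
    exact ⟨⟨z, mem_closedBall_self hr.le⟩, (convex_closedBall z r).isPreconnected⟩
  have hcongr : (fun w ↦ ‖g w‖ ^ a) =ᶠ[codiscreteWithin (sphere z |r|)]
      fun w ↦ Real.exp (a * Real.log ‖g w‖) := by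
    filter_upwards [hcod] with w hw
    rw [Real.rpow_def_of_pos (norm_pos_iff.mpr hw), mul_comm]
  have hexpint : CircleIntegrable (fun w ↦ Real.exp (a * Real.log ‖g w‖)) z r :=
    hpowint.congr_codiscreteWithin hcongr
  have : NeZero (volume.restrict (uIoc 0 (2 * Real.pi))) := 
    ⟨by simp [uIoc_of_le Real.two_pi_pos.le, Real.pi_pos]⟩
  have : IsFiniteMeasure (volume.restrict (uIoc 0 (2 * Real.pi))) := by
    rw [uIoc_of_le Real.two_pi_pos.le]; infer_instance
  calc ‖g z‖ ^ a = Real.exp (a * Real.log ‖g z‖) := by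
        rw [Real.rpow_def_of_pos (norm_pos_iff.mpr h0), mul_comm]
    _ ≤ Real.exp (a * Real.circleAverage (fun w ↦ Real.log ‖g w‖) z r) := by gcongr
    _ = Real.exp (Real.circleAverage (fun w ↦ a * Real.log ‖g w‖) z r) := by
        simp_rw [← smul_eq_mul, Real.circleAverage_fun_smul]
    _ ≤ Real.circleAverage (fun w ↦ Real.exp (a * Real.log ‖g w‖)) z r := by
        rw [Real.circleAverage_eq_intervalAverage, Real.circleAverage_eq_intervalAverage]
        exact convexOn_exp.map_average_le Real.continuous_exp.continuousOn isClosed_univ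
          (by simp) (hlogint.const_mul a).def' hexpint.def'
    _ = Real.circleAverage (fun w ↦ ‖g w‖ ^ a) z r :=
        (Real.circleAverage_congr_codiscreteWithin hcongr hr.ne').symm

lemma le_of_le_circleAverage_of_le_on_boundary {α β M T : ℝ} {V : ℂ → ℝ}
    (hV : Continuous V)
    (hmean : ∀ z : ℂ, α < z.re → z.re < β → ∃ r > 0,
      (∀ w ∈ closedBall z r, α < w.re ∧ w.re < β) ∧ V z ≤ Real.circleAverage V z r)
    (hα : ∀ z : ℂ, z.re = α → V z ≤ M) (hβ : ∀ z : ℂ, z.re = β → V z ≤ M)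
    (hT : ∀ z : ℂ, α ≤ z.re → z.re ≤ β → T ≤ |z.im| → V z ≤ M)
    {z : ℂ} (hz : α ≤ z.re ∧ z.re ≤ β) : V z ≤ M := by
  by_contra! hlt
  set R : Set ℂ := Icc α β ×ℂ Icc (-T) T with hR
  have hRc : IsCompact R := isCompact_Icc.reProdIm isCompact_Icc
  have hout : ∀ w : ℂ, α ≤ w.re → w.re ≤ β → M < V w → w ∈ R := fun w h1 h2 h3 ↦ by
    have : ¬ T ≤ |w.im| := fun h ↦ (hT w h1 h2 h).not_gt h3
    exact ⟨⟨h1, h2⟩, abs_le.mp (not_le.mp this).le⟩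
  obtain ⟨m, hmR, hm⟩ := hRc.exists_isMaxOn ⟨z, hout z hz.1 hz.2 hlt⟩ hV.continuousOn
  have hMm : M < V m := hlt.trans_le (hm (hout z hz.1 hz.2 hlt))
  obtain ⟨c, ⟨hcR, hcm⟩, hc⟩ :=
    (hRc.inter_right (isClosed_eq hV (continuous_const (y := V m)))).exists_isMaxOn ⟨m, hmR, rfl⟩
      continuous_re.continuousOn
  simp only [mem_ofPred_eq] at hcm
  have hle : ∀ w : ℂ, α ≤ w.re → w.re ≤ β → V w ≤ V m := fun w h1 h2 ↦ by
    by_contra! h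
    exact (hm (hout w h1 h2 (hMm.trans h))).not_gt h
  have hcα : α < c.re := lt_of_le_of_ne hcR.1.1 fun h ↦ by
    have := hα c h.symm; linarith
  have hcβ : c.re < β := lt_of_le_of_ne hcR.1.2 fun h ↦ by
    have := hβ c h; linarith
  obtain ⟨r, hr, hball, hsub⟩ := hmean c hcα hcβ
  have hmem : ∀ θ, circleMap c r θ ∈ closedBall c r := circleMap_mem_closedBall c hr.le
  have hcr : V (circleMap c r 0) < V m := by
    have hre : (circleMap c r 0).re = c.re + r := by simp [circleMap]
    have hb := hball _ (hmem 0)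
    refine lt_of_le_of_ne (hle _ hb.1.le hb.2.le) fun h ↦ ?_
    have h1 := hout _ hb.1.le hb.2.le (h ▸ hMm)
    have : (circleMap c r 0).re ≤ c.re := hc ⟨h1, h⟩
    linarith
  have hintegral : ∫ θ in 0..2 * Real.pi, V (circleMap c r θ) < ∫ θ in 0..2 * Real.pi, V m := by
    refine intervalIntegral.integral_lt_integral_of_continuousOn_of_le_of_exists_lt
      Real.two_pi_pos (by fun_prop) continuousOn_const (fun θ _ ↦ ?_)
      ⟨0, by simp [Real.pi_nonneg], hcr⟩
    have hb := hball _ (hmem θ)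
    exact hle _ hb.1.le hb.2.le
  rw [hcm, Real.circleAverage_def] at hsub
  rw [intervalIntegral.integral_const, smul_eq_mul, sub_zero] at hintegral
  rw [smul_eq_mul, inv_mul_eq_div, le_div_iff₀ Real.two_pi_pos] at hsub
  linarith

lemma intervalIntegral_swap_of_continuous {F : ℝ → ℝ → ℝ} (hF : Continuous (Function.uncurry F))
    (a b c d : ℝ) :
    ∫ x in a..b, ∫ y in c..d, F x y = ∫ y in c..d, ∫ x in a..b, F x y := by
  refine intervalIntegral_intervalIntegral_swap ?_
  have hintegral : IntegrableOn (Function.uncurry F) (uIcc a b ×ˢ uIcc c d) volume :=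
    hF.continuousOn.integrableOn_compact (isCompact_uIcc.prod isCompact_uIcc)
  exact hintegral.mono_set (prod_mono uIoc_subset_uIcc uIoc_subset_uIcc)

lemma intervalIntegral_le_circleAverage {h : ℂ → ℝ → ℝ} (hcont : Continuous (Function.uncurry h))
    {a b : ℝ} (hab : a ≤ b) {c : ℂ} {r : ℝ}
    (hsub : ∀ t, h c t ≤ Real.circleAverage (fun w ↦ h w t) c r) :
    ∫ t in a..b, h c t ≤ Real.circleAverage (fun w ↦ ∫ t in a..b, h w t) c r := by
  have hcc : Continuous (Function.uncurry fun t θ ↦ h (circleMap c r θ) t) :=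
    hcont.comp (((continuous_circleMap c r).comp continuous_snd).prodMk continuous_fst)
  have hleft : Continuous fun t ↦ h c t := hcont.comp (Continuous.prodMk_right c)
  have hright : Continuous fun t ↦ Real.circleAverage (fun w ↦ h w t) c r := by
    simp only [Real.circleAverage_def]
    exact Continuous.const_smul (intervalIntegral.continuous_parametric_intervalIntegral_of_continuous' (μ := volume)
      hcc 0 (2 * Real.pi)) (2 * Real.pi)⁻¹
  have hswap := intervalIntegral_swap_of_continuous hcc a b 0 (2 * Real.pi)
  refine (intervalIntegral.integral_mono_on hab (hleft.intervalIntegrable _ _)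
    (hright.intervalIntegrable _ _) fun t _ ↦ hsub t).trans_eq ?_
  simp only [Real.circleAverage_def, intervalIntegral.integral_smul]
  rw [hswap]

/-- Weighted three lines inequality for truncated vertical means of `‖f‖ ^ a`. -/
lemma integral_norm_rpow_mul_weights_le_one {α β a T : ℝ} (hαβ : α < β) (ha : 0 < a)
    (hT : 0 ≤ T) {f : ℂ → ℂ} (hf : Continuous f)
    (hanal : DifferentiableOn ℂ f {s : ℂ | α < s.re ∧ s.re < β})
    (hdecay : ∀ ε > 0, ∃ M : ℝ, ∀ z : ℂ, M ≤ |z.im| → ‖f z‖ ≤ ε)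
    {W₀ W₁ : ℝ → ℝ} (hW₀ : Continuous W₀) (hW₁ : Continuous W₁)
    (hpos₀ : ∀ t, 0 < W₀ t) (hpos₁ : ∀ t, 0 < W₁ t)
    (h₀ : ∀ z : ℂ, z.re = α → ∫ t in -T..T, ‖f (z + t * I)‖ ^ a * W₀ t ≤ 1)
    (h₁ : ∀ z : ℂ, z.re = β → ∫ t in -T..T, ‖f (z + t * I)‖ ^ a * W₁ t ≤ 1)
    {z : ℂ} (hz : α ≤ z.re ∧ z.re ≤ β) :
    ∫ t in -T..T, ‖f (z + t * I)‖ ^ a *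
      (W₀ t ^ ((β - z.re) / (β - α)) * W₁ t ^ ((z.re - α) / (β - α))) ≤ 1 := by
  have hne : β - α ≠ 0 := (sub_pos.mpr hαβ).ne'
  set h : ℂ → ℝ → ℝ := fun z t ↦ ‖f (z + t * I)‖ ^ a *
      (W₀ t ^ ((β - z.re) / (β - α)) * W₁ t ^ ((z.re - α) / (β - α))) with hh
  have hcont : Continuous (Function.uncurry h) := by
    refine Continuous.mul ?_ (Continuous.mul ?_ ?_)
    · exact Continuous.rpow_const (by fun_prop) fun _ ↦ Or.inr ha.le
    · exact Continuous.rpow (by fun_prop) (by fun_prop) fun x ↦ Or.inl (hpos₀ x.2).ne'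
    · exact Continuous.rpow (by fun_prop) (by fun_prop) fun x ↦ Or.inl (hpos₁ x.2).ne'
  have hV : Continuous fun z ↦ ∫ t in -T..T, h z t :=
    intervalIntegral.continuous_parametric_intervalIntegral_of_continuous' hcont _ _
  have hsub : ∀ (t : ℝ) (c : ℂ) (r : ℝ), 0 < r →
      (∀ w ∈ closedBall c r, α < w.re ∧ w.re < β) →
      h c t ≤ Real.circleAverage (fun w ↦ h w t) c r := by
    intro t c r hr hball
    set g : ℂ → ℂ := fun w ↦ f (w + t * I) *
      cexp (((β - w) / (β - α) * Real.log (W₀ t) + (w - α) / (β - α) * Real.log (W₁ t)) / a)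
      with hg
    have hgan : AnalyticOnNhd ℂ g (closedBall c r) := by
      have hS : IsOpen {s : ℂ | α < s.re ∧ s.re < β} :=
        (isOpen_lt continuous_const continuous_re).inter (isOpen_lt continuous_re continuous_const)
      refine AnalyticOnNhd.mono (DifferentiableOn.analyticOnNhd ?_ hS) hball
      refine DifferentiableOn.mul (hanal.comp (by fun_prop) fun w hw ↦ ?_)
        (Differentiable.differentiableOn (by fun_prop))
      simpa using hw
    have hgh : ∀ w, ‖g w‖ ^ a = h w t := by
      intro w
      have hexp : ((((β - w) / (β - α) * Real.log (W₀ t) +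
          (w - α) / (β - α) * Real.log (W₁ t)) / a : ℂ)).re =
          ((β - w.re) / (β - α) * Real.log (W₀ t) +
            (w.re - α) / (β - α) * Real.log (W₁ t)) / a := by
        rw [div_ofReal_re, add_re, re_mul_ofReal, re_mul_ofReal, ← ofReal_sub, div_ofReal_re,
          div_ofReal_re]
        simp
      rw [hg, hh]
      simp only
      rw [norm_mul, Complex.norm_exp, hexp, Real.mul_rpow (norm_nonneg _) (Real.exp_pos _).le,
        ← Real.exp_mul, div_mul_cancel₀ _ ha.ne', Real.exp_add, Real.rpow_def_of_pos (hpos₀ t),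
        Real.rpow_def_of_pos (hpos₁ t), mul_comm (Real.log (W₀ t)), mul_comm (Real.log (W₁ t))]
    simpa only [hgh] using hgan.norm_rpow_le_circleAverage hr ha
  have hIoo : (-T) ≤ T := by linarith
  set C := ∫ t in -T..T, (W₀ t + W₁ t) with hC
  have hCnn : 0 ≤ C := intervalIntegral.integral_nonneg hIoo fun t _ ↦
    (add_pos (hpos₀ t) (hpos₁ t)).le
  obtain ⟨M, hM⟩ := hdecay ((1 / (C + 1)) ^ (1 / a)) (by positivity)
  refine le_of_le_circleAverage_of_le_on_boundary (V := fun z ↦ ∫ t in -T..T, h z t)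
    (T := M + T) hV ?_ ?_ ?_ ?_ hz
  · intro c hcα hcβ
    obtain ⟨r, hr, hrα, hrβ⟩ : ∃ r > 0, r < c.re - α ∧ r < β - c.re := by
      obtain ⟨r, hr, hr'⟩ := exists_between (lt_min (sub_pos.mpr hcα) (sub_pos.mpr hcβ))
      exact ⟨r, hr, (lt_min_iff.mp hr').1, (lt_min_iff.mp hr').2⟩
    have hball : ∀ w ∈ closedBall c r, α < w.re ∧ w.re < β := by
      intro w hw
      rw [mem_closedBall, dist_eq_norm] at hw
      have := abs_le.mp ((abs_re_le_norm (w - c)).trans hw)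
      rw [sub_re] at this
      constructor <;> linarith [this.1, this.2]
    refine ⟨r, hr, hball, ?_⟩
    exact intervalIntegral_le_circleAverage hcont hIoo fun t ↦ hsub t c r hr hball
  · intro w hw
    simpa [hh, hw, hne] using h₀ w hw
  · intro w hw
    simpa [hh, hw, hne] using h₁ w hw
  · intro w hwα hwβ hwM
    have hp : 0 ≤ (β - w.re) / (β - α) := div_nonneg (by linarith) (by linarith)
    have hq : 0 ≤ (w.re - α) / (β - α) := div_nonneg (by linarith) (by linarith)
    have hpq : (β - w.re) / (β - α) + (w.re - α) / (β - α) = 1 := by field_simp; ring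
    calc ∫ t in -T..T, h w t ≤ ∫ t in -T..T, 1 / (C + 1) * (W₀ t + W₁ t) := by
          have hleft : Continuous fun t ↦ h w t := hcont.comp (Continuous.prodMk_right w)
          have hright : Continuous fun t ↦ 1 / (C + 1) * (W₀ t + W₁ t) := by fun_prop
          refine intervalIntegral.integral_mono_on hIoo (hleft.intervalIntegrable _ _)
            (hright.intervalIntegrable _ _) fun t ht ↦ ?_
          have hft : ‖f (w + t * I)‖ ≤ (1 / (C + 1)) ^ (1 / a) := by
            refine hM _ ?_
            have h1 : |t| ≤ T := abs_le.mpr ht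
            have h2 : |w.im| ≤ |w.im + t| + |t| := by
              simpa using abs_sub (w.im + t) t
            simp only [add_im, mul_im, ofReal_re, ofReal_im, I_re, I_im, mul_one, mul_zero,
              add_zero]
            linarith
          have hfa : ‖f (w + t * I)‖ ^ a ≤ 1 / (C + 1) := by
            calc _ ≤ ((1 / (C + 1)) ^ (1 / a)) ^ a := by gcongr
              _ = 1 / (C + 1) := by
                rw [← Real.rpow_mul (by positivity), one_div_mul_cancel ha.ne', Real.rpow_one]
          have hw0 := (hpos₀ t).le
          have hw1 := (hpos₁ t).le
          have hWW : W₀ t ^ ((β - w.re) / (β - α)) * W₁ t ^ ((w.re - α) / (β - α))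
              ≤ W₀ t + W₁ t := by
            refine (Real.geom_mean_le_arith_mean2_weighted hp hq hw0 hw1 hpq).trans ?_
            nlinarith
          exact mul_le_mul hfa hWW (mul_nonneg (by positivity) (by positivity)) (by positivity)
      _ = 1 / (C + 1) * C := by rw [intervalIntegral.integral_const_mul]
      _ ≤ 1 := by
          rw [one_div_mul_eq_div, div_le_one (by positivity)]; linarith

lemma ofReal_intervalIntegral_eq_setLIntegral {φ : ℝ → ℝ} {a b : ℝ} (hab : a ≤ b)
    (hφ : Continuous φ) (hnn : ∀ t, 0 ≤ φ t) :
    ENNReal.ofReal (∫ t in a..b, φ t) = ∫⁻ t in Ioc a b, ENNReal.ofReal (φ t) := by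
  rw [intervalIntegral.integral_of_le hab]
  exact ofReal_integral_eq_lintegral_ofReal hφ.integrableOn_Ioc (ae_of_all _ hnn)

/-- Hölder's inequality for interval integrals, with exponents `θ` and `1 - θ`. -/
lemma intervalIntegral_rpow_mul_rpow_le {F w : ℝ → ℝ} {a b θ : ℝ} (hab : a ≤ b)
    (hF : Continuous F) (hw : Continuous w) (hFnn : ∀ t, 0 ≤ F t) (hwnn : ∀ t, 0 ≤ w t)
    (hθ₀ : 0 ≤ θ) (hθ₁ : θ ≤ 1) :
    ∫ t in a..b, F t ^ θ * w t ^ (1 - θ) ≤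
      (∫ t in a..b, F t) ^ θ * (∫ t in a..b, w t) ^ (1 - θ) := by
  have hθ₁' : 0 ≤ 1 - θ := sub_nonneg.mpr hθ₁
  have hIF : 0 ≤ ∫ t in a..b, F t := intervalIntegral.integral_nonneg hab fun t _ ↦ hFnn t
  have hIw : 0 ≤ ∫ t in a..b, w t := intervalIntegral.integral_nonneg hab fun t _ ↦ hwnn t
  rw [← ENNReal.ofReal_le_ofReal_iff (by positivity), ENNReal.ofReal_mul (by positivity),
    ← ENNReal.ofReal_rpow_of_nonneg hIF hθ₀, ← ENNReal.ofReal_rpow_of_nonneg hIw hθ₁',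
    ofReal_intervalIntegral_eq_setLIntegral hab hF hFnn,
    ofReal_intervalIntegral_eq_setLIntegral hab hw hwnn,
    ofReal_intervalIntegral_eq_setLIntegral (φ := fun t ↦ F t ^ θ * w t ^ (1 - θ)) hab
      ((hF.rpow_const fun _ ↦ Or.inr hθ₀).mul (hw.rpow_const fun _ ↦ Or.inr hθ₁'))
      fun t ↦ mul_nonneg (Real.rpow_nonneg (hFnn t) _) (Real.rpow_nonneg (hwnn t) _)]
  refine le_trans (le_of_eq ?_) (ENNReal.lintegral_mul_norm_pow_le
    hF.measurable.ennreal_ofReal.aemeasurable hw.measurable.ennreal_ofReal.aemeasurable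
    hθ₀ hθ₁' (by ring))
  refine lintegral_congr fun t ↦ ?_
  rw [ENNReal.ofReal_mul (Real.rpow_nonneg (hFnn t) _),
    ENNReal.ofReal_rpow_of_nonneg (hFnn t) hθ₀, ENNReal.ofReal_rpow_of_nonneg (hwnn t) hθ₁']

/-- Gabriel's convexity theorem for means over a bounded interval. -/
lemma integral_norm_rpow_le_interp {α β lam μ A B T : ℝ} (hαβ : α < β) (hlam : 0 < lam)
    (hμ : 0 < μ) (hA : 0 < A) (hB : 0 < B) (hT : 0 < T) {f : ℂ → ℂ} (hf : Continuous f)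
    (hanal : DifferentiableOn ℂ f {s : ℂ | α < s.re ∧ s.re < β})
    (hdecay : ∀ ε > 0, ∃ M : ℝ, ∀ z : ℂ, M ≤ |z.im| → ‖f z‖ ≤ ε)
    (h₀ : ∀ z : ℂ, z.re = α → ∫ t in -T..T, ‖f (z + t * I)‖ ^ (1 / lam) ≤ A ^ (1 / lam))
    (h₁ : ∀ z : ℂ, z.re = β → ∫ t in -T..T, ‖f (z + t * I)‖ ^ (1 / μ) ≤ B ^ (1 / μ))
    {z : ℂ} {p q ν : ℝ} (hz : α < z.re ∧ z.re < β) (hp : p = (β - z.re) / (β - α))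
    (hq : q = (z.re - α) / (β - α)) (hν : ν = p * lam + q * μ) :
    ∫ t in -T..T, ‖f (z + t * I)‖ ^ (1 / ν) ≤ (A ^ p * B ^ q) ^ (1 / ν) := by
  have hp0 : 0 < p := hp ▸ div_pos (sub_pos.mpr hz.2) (sub_pos.mpr hαβ)
  have hq0 : 0 < q := hq ▸ div_pos (sub_pos.mpr hz.1) (sub_pos.mpr hαβ)
  have hpq : p + q = 1 := by
    have : β - α ≠ 0 := (sub_pos.mpr hαβ).ne'
    rw [hp, hq]; field_simp; ring
  have hν0 : 0 < ν := hν ▸ by positivity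
  have hTT : -T ≤ T := by linarith
  obtain ⟨a, ha, hal, ham⟩ : ∃ a : ℝ, 0 < a ∧ a * lam < 1 ∧ a * μ < 1 := by
    refine ⟨1 / (lam + μ), by positivity, ?_, ?_⟩ <;>
    · rw [one_div_mul_eq_div, div_lt_one (by positivity)]; linarith
  have hexp : p * (1 - a * lam) + q * (1 - a * μ) = 1 - a * ν := by
    rw [hν]; linear_combination hpq
  have hav : 0 < 1 - a * ν := by
    rw [← hexp]
    exact add_pos (mul_pos hp0 (sub_pos.mpr hal)) (mul_pos hq0 (sub_pos.mpr ham))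
  set C := A ^ p * B ^ q with hC
  have hC0 : 0 < C := by positivity
  set φ : ℝ → ℝ := fun t ↦ ‖f (z + t * I)‖ with hφ
  have hφc : Continuous φ := by fun_prop
  have hφν : Continuous fun t ↦ φ t ^ (1 / ν) :=
    hφc.rpow_const fun _ ↦ Or.inr (by positivity)
  set X := ∫ t in -T..T, φ t ^ (1 / ν) with hX
  have hX0 : 0 ≤ X := intervalIntegral.integral_nonneg hTT fun t _ ↦ by positivity
  have hedge : ∀ {w : ℝ → ℝ} {κ D : ℝ}, Continuous w → (∀ t, 0 < w t) → 0 < κ → a * κ < 1 →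
      0 < D → ∀ c : ℂ, ∫ t in -T..T, ‖f (c + t * I)‖ ^ (1 / κ) ≤ D ^ (1 / κ) →
      ∫ t in -T..T, ‖f (c + t * I)‖ ^ a *
        (w t ^ (1 - a * κ) / (D ^ a * (∫ t in -T..T, w t) ^ (1 - a * κ))) ≤ 1 := by
    intro w κ D hw hwpos hκ haκ hD c hc
    have hW : 0 < ∫ t in -T..T, w t :=
      intervalIntegral.intervalIntegral_pos_of_pos (hw.intervalIntegrable _ _) hwpos (by linarith)
    simp_rw [← mul_div_assoc, intervalIntegral.integral_div]
    rw [div_le_one (by positivity)]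
    calc ∫ t in -T..T, ‖f (c + t * I)‖ ^ a * w t ^ (1 - a * κ)
        = ∫ t in -T..T, (‖f (c + t * I)‖ ^ (1 / κ)) ^ (a * κ) * w t ^ (1 - a * κ) := by
          refine intervalIntegral.integral_congr fun t _ ↦ ?_
          rw [← Real.rpow_mul (norm_nonneg _)]
          congr 2
          field_simp
      _ ≤ (∫ t in -T..T, ‖f (c + t * I)‖ ^ (1 / κ)) ^ (a * κ) *
            (∫ t in -T..T, w t) ^ (1 - a * κ) :=
          intervalIntegral_rpow_mul_rpow_le hTT
            (Continuous.rpow_const (by fun_prop) fun _ ↦ Or.inr (by positivity)) hw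
            (fun t ↦ by positivity) (fun t ↦ (hwpos t).le) (by positivity) haκ.le
      _ ≤ (D ^ (1 / κ)) ^ (a * κ) * (∫ t in -T..T, w t) ^ (1 - a * κ) := by
          gcongr
          exact intervalIntegral.integral_nonneg hTT fun t _ ↦ by positivity
      _ = D ^ a * (∫ t in -T..T, w t) ^ (1 - a * κ) := by
          rw [← Real.rpow_mul hD.le]
          congr 2
          field_simp
  have hδ : ∀ δ > 0, X ≤ C ^ a * (X + 2 * T * δ) ^ (1 - a * ν) := by
    intro δ hδ
    set w : ℝ → ℝ := fun t ↦ φ t ^ (1 / ν) + δ with hw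
    have hwc : Continuous w := hφν.add continuous_const
    have hwpos : ∀ t, 0 < w t := fun t ↦ by positivity
    have hWeq : ∫ t in -T..T, w t = X + 2 * T * δ := by
      rw [hw, intervalIntegral.integral_add (hφν.intervalIntegrable _ _) (by simp),
        intervalIntegral.integral_const, smul_eq_mul]
      ring
    set W := X + 2 * T * δ with hW
    have hWpos : 0 < W := by positivity
    have hWc : ∀ κ D : ℝ, Continuous fun t ↦ w t ^ (1 - a * κ) / (D ^ a * W ^ (1 - a * κ)) :=
      fun κ D ↦ (hwc.rpow_const fun t ↦ Or.inl (hwpos t).ne').div_const _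
    have key := integral_norm_rpow_mul_weights_le_one hαβ ha hT.le hf hanal hdecay
      (hWc lam A) (hWc μ B) (fun t ↦ by have := hwpos t; positivity)
      (fun t ↦ by have := hwpos t; positivity)
      (fun c hc ↦ by simpa only [hWeq] using hedge hwc hwpos hlam hal hA c (h₀ c hc))
      (fun c hc ↦ by simpa only [hWeq] using hedge hwc hwpos hμ ham hB c (h₁ c hc))
      ⟨hz.1.le, hz.2.le⟩
    rw [← hp, ← hq] at key
    have hweights : ∀ t, (w t ^ (1 - a * lam) / (A ^ a * W ^ (1 - a * lam))) ^ p *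
        (w t ^ (1 - a * μ) / (B ^ a * W ^ (1 - a * μ))) ^ q =
        w t ^ (1 - a * ν) / (C ^ a * W ^ (1 - a * ν)) := by
      intro t
      have hwt := hwpos t
      have hmul : ∀ x : ℝ, 0 < x →
          (x ^ (1 - a * lam)) ^ p * (x ^ (1 - a * μ)) ^ q = x ^ (1 - a * ν) := by
        intro x hx
        rw [← Real.rpow_mul hx.le, ← Real.rpow_mul hx.le, ← Real.rpow_add hx, ← hexp]
        ring_nf
      have hCa : C ^ a = (A ^ a) ^ p * (B ^ a) ^ q := by
        rw [hC, Real.mul_rpow (by positivity) (by positivity), ← Real.rpow_mul hA.le,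
          ← Real.rpow_mul hB.le, ← Real.rpow_mul hA.le, ← Real.rpow_mul hB.le, mul_comm p,
          mul_comm q]
      rw [Real.div_rpow (by positivity) (by positivity),
        Real.div_rpow (by positivity) (by positivity), Real.mul_rpow (by positivity) (by positivity),
        Real.mul_rpow (by positivity) (by positivity), div_mul_div_comm, hmul _ hwt,
        mul_mul_mul_comm, hmul _ hWpos, hCa]
    simp_rw [hweights, ← mul_div_assoc, intervalIntegral.integral_div] at key
    rw [div_le_one (by positivity)] at key
    refine le_trans (intervalIntegral.integral_mono_on hTT (hφν.intervalIntegrable _ _)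
      (Continuous.intervalIntegrable ?_ _ _) fun t _ ↦ ?_) key
    · exact (hφc.rpow_const fun _ ↦ Or.inr ha.le).mul
        (hwc.rpow_const fun t ↦ Or.inl (hwpos t).ne')
    · have hφt : 0 ≤ φ t := norm_nonneg _
      calc φ t ^ (1 / ν) = φ t ^ a * (φ t ^ (1 / ν)) ^ (1 - a * ν) := by
            rw [← Real.rpow_mul hφt, ← Real.rpow_add_of_nonneg hφt ha.le (by positivity)]
            congr 1
            field_simp
            ring
        _ ≤ φ t ^ a * w t ^ (1 - a * ν) := by
            gcongr
            exact le_add_of_nonneg_right hδ.le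
  have hlim : X ≤ C ^ a * X ^ (1 - a * ν) := by
    have ht : Tendsto (fun δ : ℝ ↦ C ^ a * (X + 2 * T * δ) ^ (1 - a * ν)) (𝓝[>] 0)
        (𝓝 (C ^ a * X ^ (1 - a * ν))) := by
      have hcont : Continuous fun δ : ℝ ↦ C ^ a * (X + 2 * T * δ) ^ (1 - a * ν) :=
        continuous_const.mul (Continuous.rpow_const (by fun_prop) fun _ ↦ Or.inr hav.le)
      have := hcont.tendsto 0
      rw [mul_zero, add_zero] at this
      exact this.mono_left nhdsWithin_le_nhds
    exact ge_of_tendsto ht (eventually_mem_nhdsWithin.mono hδ)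
  rcases hX0.eq_or_lt with h | h
  · rw [← h]; positivity
  have hXa : X ^ (a * ν) ≤ C ^ a := by
    rw [Real.rpow_sub h, Real.rpow_one, ← mul_div_assoc, le_div_iff₀ (by positivity),
      mul_comm X] at hlim
    exact le_of_mul_le_mul_right hlim h
  calc X = (X ^ (a * ν)) ^ (1 / (a * ν)) := by
        rw [← Real.rpow_mul hX0, mul_one_div_cancel (by positivity), Real.rpow_one]
    _ ≤ (C ^ a) ^ (1 / (a * ν)) := by gcongr
    _ = C ^ (1 / ν) := by
        rw [← Real.rpow_mul hC0.le]
        congr 1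
        field_simp

lemma eq_zero_of_lintegral_norm_rpow_eq_zero {φ : ℝ → ℂ} {k : ℝ} (hφ : Continuous φ)
    (hk : 0 < k) (h : ∫⁻ t, ENNReal.ofReal (‖φ t‖ ^ k) = 0) (t : ℝ) : φ t = 0 := by
  have hc : Continuous fun t ↦ ENNReal.ofReal (‖φ t‖ ^ k) :=
    ENNReal.continuous_ofReal.comp (hφ.norm.rpow_const fun _ ↦ Or.inr hk.le)
  have h0 := (hc.ae_eq_iff_eq volume continuous_const).mp
    ((lintegral_eq_zero_iff hc.measurable).mp h)
  have ht := ENNReal.ofReal_eq_zero.mp (congrFun h0 t)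
  have : ‖φ t‖ ^ k = 0 := le_antisymm ht (by positivity)
  exact norm_eq_zero.mp ((Real.rpow_eq_zero (norm_nonneg _) hk.ne').mp this)

/-- A bounded holomorphic function on a strip vanishing on one of the edges vanishes inside. -/
lemma eq_zero_of_eq_zero_on_edge {α β : ℝ} (hαβ : α < β) {f : ℂ → ℂ} (hf : Continuous f)
    (hanal : DifferentiableOn ℂ f {s : ℂ | α < s.re ∧ s.re < β})
    (hdecay : ∀ ε > 0, ∃ M : ℝ, ∀ z : ℂ, M ≤ |z.im| → ‖f z‖ ≤ ε)
    (h : (∀ z : ℂ, z.re = α → f z = 0) ∨ (∀ z : ℂ, z.re = β → f z = 0))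
    {z : ℂ} (hz : α < z.re ∧ z.re < β) : f z = 0 := by
  obtain ⟨K, hK⟩ : ∃ K : ℝ, ∀ w : ℂ, α ≤ w.re → w.re ≤ β → ‖f w‖ ≤ K := by
    obtain ⟨M, hM⟩ := hdecay 1 one_pos
    obtain ⟨K, hK⟩ := ((isCompact_Icc (a := α) (b := β)).reProdIm
      (isCompact_Icc (a := -M) (b := M))).exists_bound_of_continuousOn hf.continuousOn
    refine ⟨max K 1, fun w h1 h2 ↦ ?_⟩
    rcases le_total M |w.im| with hw | hw
    · exact (hM w hw).trans (le_max_right _ _)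
    · exact (hK w ⟨⟨h1, h2⟩, abs_le.mp hw⟩).trans (le_max_left _ _)
  have hz' : z ∈ HadamardThreeLines.verticalClosedStrip α β := ⟨hz.1.le, hz.2.le⟩
  have hd : DiffContOnCl ℂ f (HadamardThreeLines.verticalStrip α β) :=
    ⟨hanal, hf.continuousOn⟩
  have hbdd : BddAbove ((norm ∘ f) '' HadamardThreeLines.verticalClosedStrip α β) := by
    refine ⟨K, ?_⟩
    rintro _ ⟨w, hw, rfl⟩
    exact hK w hw.1 hw.2
  have hα : ∀ w ∈ re ⁻¹' {α}, ‖f w‖ ≤ K := fun w hw ↦ by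
    have hw : w.re = α := hw
    exact hK w hw.ge (hw.trans_le hαβ.le)
  have hβ : ∀ w ∈ re ⁻¹' {β}, ‖f w‖ ≤ K := fun w hw ↦ by
    have hw : w.re = β := hw
    exact hK w (hαβ.le.trans hw.ge) hw.le
  have hlt : (z.re - α) / (β - α) < 1 := by
    rw [div_lt_one (sub_pos.mpr hαβ)]; linarith [hz.2]
  have hpos : 0 < (z.re - α) / (β - α) := div_pos (sub_pos.mpr hz.1) (sub_pos.mpr hαβ)
  refine norm_le_zero_iff.mp ?_
  rcases h with h | h
  · refine (HadamardThreeLines.norm_le_interp_of_mem_verticalClosedStrip' hαβ hz' hd hbdd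
      (a := 0) (fun w hw ↦ by simp [h w hw]) hβ).trans_eq ?_
    rw [Real.zero_rpow (sub_pos.mpr hlt).ne', zero_mul]
  · refine (HadamardThreeLines.norm_le_interp_of_mem_verticalClosedStrip' hαβ hz' hd hbdd
      (b := 0) hα (fun w hw ↦ by simp [h w hw])).trans_eq ?_
    rw [Real.zero_rpow hpos.ne', mul_zero]

/-- Gabriel's convexity theorem for functions continuous on the whole plane. -/
lemma lintegral_norm_rpow_le_interp {α β lam μ σ p q : ℝ} (hαβ : α < β) (hlam : 0 < lam)
    (hμ : 0 < μ) {f : ℂ → ℂ} (hf : Continuous f)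
    (hanal : DifferentiableOn ℂ f {s : ℂ | α < s.re ∧ s.re < β})
    (hdecay : ∀ ε > 0, ∃ M : ℝ, ∀ z : ℂ, M ≤ |z.im| → ‖f z‖ ≤ ε)
    (hσ : α < σ ∧ σ < β) (hp : p = (β - σ) / (β - α)) (hq : q = (σ - α) / (β - α))
    {J : ℝ → ℝ → ℝ≥0∞}
    (hJ : ∀ x κ, J x κ = (∫⁻ t : ℝ, ENNReal.ofReal (‖f (x + t * I)‖ ^ (1 / κ))) ^ κ) :
    J σ (p * lam + q * μ) ≤ J α lam ^ p * J β μ ^ q := by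
  have hp0 : 0 < p := hp ▸ div_pos (sub_pos.mpr hσ.2) (sub_pos.mpr hαβ)
  have hq0 : 0 < q := hq ▸ div_pos (sub_pos.mpr hσ.1) (sub_pos.mpr hαβ)
  set ν := p * lam + q * μ with hν
  have hν0 : 0 < ν := by positivity
  have hline : ∀ {x κ : ℝ}, 0 < κ → J x κ = 0 → ∀ z : ℂ, z.re = x → f z = 0 := by
    intro x κ hκ h z hz
    rw [hJ, ENNReal.rpow_eq_zero_iff_of_pos hκ] at h
    have := eq_zero_of_lintegral_norm_rpow_eq_zero (φ := fun t : ℝ ↦ f (x + t * I))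
      (by fun_prop) (one_div_pos.mpr hκ) h z.im
    rwa [← hz, re_add_im] at this
  by_cases h0 : J α lam = 0 ∨ J β μ = 0
  · have hzero : ∀ t : ℝ, f (σ + t * I) = 0 := fun t ↦
      eq_zero_of_eq_zero_on_edge hαβ hf hanal hdecay (h0.imp (hline hlam) (hline hμ))
        (by simpa using hσ)
    have : J σ ν = 0 := by
      rw [hJ]
      simp [hzero, Real.zero_rpow (inv_pos.mpr hν0).ne', hν0]
    rw [this]
    exact zero_le
  push Not at h0
  by_cases htop : J α lam = ⊤ ∨ J β μ = ⊤
  · refine le_top.trans_eq (Eq.symm ?_)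
    rcases htop with h | h
    · rw [h, ENNReal.top_rpow_of_pos hp0, ENNReal.top_mul]
      simp [ENNReal.rpow_eq_zero_iff, h0.2, hq0.not_gt]
    · rw [h, ENNReal.top_rpow_of_pos hq0, ENNReal.mul_top]
      simp [ENNReal.rpow_eq_zero_iff, h0.1, hp0.not_gt]
  push Not at htop
  have hcont : ∀ (z : ℂ) {κ : ℝ}, 0 < κ → Continuous fun t : ℝ ↦ ‖f (z + t * I)‖ ^ (1 / κ) :=
    fun z κ hκ ↦ Continuous.rpow_const (by fun_prop) fun _ ↦ Or.inr (one_div_pos.mpr hκ).le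
  have hedge : ∀ {x κ T : ℝ}, 0 < κ → 0 < T → J x κ ≠ ⊤ → ∀ z : ℂ, z.re = x →
      ∫ t in -T..T, ‖f (z + t * I)‖ ^ (1 / κ) ≤ (J x κ).toReal ^ (1 / κ) := by
    intro x κ T hκ hT hfin z hz
    rw [← ENNReal.ofReal_le_ofReal_iff (by positivity),
      ofReal_intervalIntegral_eq_setLIntegral (by linarith) (hcont z hκ)
        (fun t ↦ by positivity), ← ENNReal.ofReal_rpow_of_nonneg ENNReal.toReal_nonneg
        (by positivity), ENNReal.ofReal_toReal hfin, hJ, ← ENNReal.rpow_mul,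
      mul_one_div_cancel hκ.ne', ENNReal.rpow_one]
    refine (setLIntegral_le_lintegral _ _).trans_eq ?_
    rw [← lintegral_add_left_eq_self
      (fun t : ℝ ↦ ENNReal.ofReal (‖f (x + t * I)‖ ^ (1 / κ))) z.im]
    refine lintegral_congr fun t ↦ ?_
    congr 4
    apply Complex.ext <;> simp [hz]
  set A := (J α lam).toReal with hA
  set B := (J β μ).toReal with hB
  have hA0 : 0 < A := ENNReal.toReal_pos h0.1 htop.1
  have hB0 : 0 < B := ENNReal.toReal_pos h0.2 htop.2
  have hbound : ∫⁻ t : ℝ, ENNReal.ofReal (‖f (σ + t * I)‖ ^ (1 / ν)) ≤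
      ENNReal.ofReal ((A ^ p * B ^ q) ^ (1 / ν)) := by
    have hlim := (aecover_Ioc (μ := volume) (tendsto_neg_atTop_atBot (G := ℝ))
      tendsto_id).lintegral_tendsto_of_countably_generated
        (hcont σ hν0).measurable.ennreal_ofReal.aemeasurable
    refine le_of_tendsto hlim ((eventually_gt_atTop 0).mono fun T hT ↦ ?_)
    rw [id, ← ofReal_intervalIntegral_eq_setLIntegral (by linarith) (hcont σ hν0)
      fun t ↦ by positivity]
    exact ENNReal.ofReal_le_ofReal (integral_norm_rpow_le_interp hαβ hlam hμ hA0 hB0 hT hf hanal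
      hdecay (hedge hlam hT htop.1) (hedge hμ hT htop.2) hσ hp hq hν)
  calc J σ ν ≤ ENNReal.ofReal ((A ^ p * B ^ q) ^ (1 / ν)) ^ ν := by
        rw [hJ]
        exact ENNReal.rpow_le_rpow hbound hν0.le
    _ = J α lam ^ p * J β μ ^ q := by
        rw [← ENNReal.ofReal_rpow_of_nonneg (by positivity) (by positivity), ← ENNReal.rpow_mul,
          one_div_mul_cancel hν0.ne', ENNReal.rpow_one, ENNReal.ofReal_mul (by positivity),
          ← ENNReal.ofReal_rpow_of_nonneg hA0.le hp0.le,
          ← ENNReal.ofReal_rpow_of_nonneg hB0.le hq0.le, hA, hB,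
          ENNReal.ofReal_toReal htop.1, ENNReal.ofReal_toReal htop.2]

/-- Gabriel's convexity theorem for vertical-line means on a strip. -/
theorem stmt6 (α β : ℝ) (hαβ : α < β) (f : ℂ → ℂ)
    (hcont : ContinuousOn f {s : ℂ | α ≤ s.re ∧ s.re ≤ β})
    (hanal : DifferentiableOn ℂ f {s : ℂ | α < s.re ∧ s.re < β})
    (hdecay : ∀ ε : ℝ, 0 < ε → ∃ M : ℝ, ∀ t : ℝ, M ≤ |t| →
      ∀ σ ∈ Set.Icc α β, ‖f (↑σ + ↑t * I)‖ ≤ ε)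
    (J : ℝ → ℝ → ℝ≥0∞)
    (hJ : ∀ σ lam, J σ lam =
      (∫⁻ t : ℝ, (‖f (↑σ + ↑t * I)‖₊ : ℝ≥0∞) ^ ((1 : ℝ) / lam)) ^ lam)
    (lam μ : ℝ) (hlam : 0 < lam) (hμ : 0 < μ)
    (σ : ℝ) (hσ1 : α < σ) (hσ2 : σ < β) :
    J σ ((β - σ) / (β - α) * lam + (σ - α) / (β - α) * μ) ≤
      J α lam ^ ((β - σ) / (β - α)) * J β μ ^ ((σ - α) / (β - α)) := by
  -- Extend `f` continuously to the plane, constantly along horizontal rays outside the strip.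
  set c : ℝ → ℝ := fun x ↦ max α (min x β) with hc
  have hcmem : ∀ x, c x ∈ Icc α β := fun x ↦
    ⟨le_max_left _ _, max_le hαβ.le (min_le_right _ _)⟩
  have hcid : ∀ x ∈ Icc α β, c x = x := fun x hx ↦ by
    simp only [hc]
    rw [min_eq_left hx.2, max_eq_right hx.1]
  set g : ℂ → ℂ := fun z ↦ f (c z.re + z.im * I) with hg
  have hgc : Continuous g := by
    refine hcont.comp_continuous (by fun_prop) fun z ↦ ?_
    simpa using hcmem z.re
  have hgf : ∀ z : ℂ, z.re ∈ Icc α β → g z = f z := fun z hz ↦ by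
    rw [hg]
    simp only
    rw [hcid _ hz, re_add_im]
  have hganal : DifferentiableOn ℂ g {s : ℂ | α < s.re ∧ s.re < β} :=
    hanal.congr fun z hz ↦ hgf z ⟨hz.1.le, hz.2.le⟩
  have hgdecay : ∀ ε > 0, ∃ M : ℝ, ∀ z : ℂ, M ≤ |z.im| → ‖g z‖ ≤ ε := fun ε hε ↦ by
    obtain ⟨M, hM⟩ := hdecay ε hε
    exact ⟨M, fun z hz ↦ hM z.im hz _ (hcmem z.re)⟩
  have hJg : ∀ x κ, x ∈ Icc α β → 0 < κ →
      J x κ = (∫⁻ t : ℝ, ENNReal.ofReal (‖g (x + t * I)‖ ^ (1 / κ))) ^ κ := by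
    intro x κ hx hκ
    rw [hJ]
    congr 1
    refine lintegral_congr fun t ↦ ?_
    rw [hgf _ (by simpa using hx), ← ENNReal.ofReal_rpow_of_nonneg (norm_nonneg _) (by positivity),
      ofReal_norm, enorm_eq_nnnorm]
  have hν : 0 < (β - σ) / (β - α) * lam + (σ - α) / (β - α) * μ :=
    add_pos (mul_pos (div_pos (sub_pos.mpr hσ2) (sub_pos.mpr hαβ)) hlam)
      (mul_pos (div_pos (sub_pos.mpr hσ1) (sub_pos.mpr hαβ)) hμ)
  rw [hJg σ _ ⟨hσ1.le, hσ2.le⟩ hν, hJg α lam ⟨le_rfl, hαβ.le⟩ hlam, hJg β μ ⟨hαβ.le, le_rfl⟩ hμ]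
  exact lintegral_norm_rpow_le_interp hαβ hlam hμ hgc hganal hgdecay ⟨hσ1, hσ2⟩ rfl rfl
    (J := fun x κ ↦ (∫⁻ t : ℝ, ENNReal.ofReal (‖g (x + t * I)‖ ^ (1 / κ))) ^ κ) fun _ _ ↦ rfl
end

section
/- For every ε > 0 there is a constant C = C(ε) > 0 such that ∫_T^{2T} |ζ(σ+it)|^2 dt ≤ C·T^{1+ε} uniformly for all σ with 1/2 ≤ σ ≤ 1 and all T ≥ 1, where ζ is the Riemann zeta function. -/
open Complex

section Plancherel

open MeasureTheory FourierTransform SchwartzMap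
open scoped ContDiff

/-- The `L²` Fourier transform of an integrable function is its Fourier integral. -/
theorem coeFn_fourier_toLp_two {h : ℝ → ℂ} (h1 : Integrable h) (h2 : MemLp h 2) :
    ((𝓕 (h2.toLp h) : Lp ℂ 2 (volume : Measure ℝ)) : ℝ → ℂ) =ᵐ[volume] 𝓕 h := by
  have hcont : Continuous (𝓕 h) :=
    VectorFourier.fourierIntegral_continuous Real.continuous_fourierChar
      (by exact continuous_inner) h1
  refine ae_eq_of_integral_contDiff_smul_eq
    ((Lp.memLp (𝓕 (h2.toLp h))).locallyIntegrable one_le_two) hcont.locallyIntegrable ?_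
  intro g g_smooth g_cpt
  have hg₁ : HasCompactSupport (Complex.ofRealCLM ∘ g) := g_cpt.comp_left rfl
  have hg₂ : ContDiff ℝ ∞ (Complex.ofRealCLM ∘ g) := by fun_prop
  set φ : 𝓢(ℝ, ℂ) := hg₁.toSchwartzMap hg₂ with hφ
  have hφg : ∀ x, φ x = (g x : ℂ) := fun x ↦ by simp [hφ]
  have key := DFunLike.congr_fun (Lp.fourier_toTemperedDistribution_eq (h2.toLp h)) φ
  rw [TemperedDistribution.fourier_apply, Lp.toTemperedDistribution_apply,
    Lp.toTemperedDistribution_apply] at key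
  have flip : ∫ ξ, 𝓕 (φ : ℝ → ℂ) ξ • h ξ = ∫ x, φ x • 𝓕 h x := by
    simpa using! VectorFourier.integral_fourierIntegral_smul_eq_flip (L := innerₗ ℝ)
      Real.continuous_fourierChar continuous_inner φ.integrable h1
  calc ∫ x, g x • (𝓕 (h2.toLp h) : Lp ℂ 2 (volume : Measure ℝ)) x
      = ∫ x, φ x • (𝓕 (h2.toLp h) : Lp ℂ 2 (volume : Measure ℝ)) x := by simp [hφg]
    _ = ∫ x, 𝓕 φ x • (h2.toLp h : ℝ → ℂ) x := key.symm
    _ = ∫ x, 𝓕 (φ : ℝ → ℂ) x • h x := by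
      refine integral_congr_ae ?_
      filter_upwards [h2.coeFn_toLp] with x hx
      rw [hx, SchwartzMap.fourier_coe]
    _ = ∫ x, g x • 𝓕 h x := by rw [flip]; simp [hφg]

theorem memLp_two_fourier {h : ℝ → ℂ} (h1 : Integrable h) (h2 : MemLp h 2) :
    MemLp (𝓕 h) 2 :=
  (memLp_congr_ae (coeFn_fourier_toLp_two h1 h2)).1 (Lp.memLp _)

theorem integral_norm_sq_fourier {h : ℝ → ℂ} (h1 : Integrable h) (h2 : MemLp h 2) :
    ∫ ξ, ‖𝓕 h ξ‖ ^ 2 = ∫ x, ‖h x‖ ^ 2 := by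
  have norm_eq (f : ℝ → ℂ) (hf : MemLp f 2) : ∫ x, ‖f x‖ ^ 2 = ‖hf.toLp f‖ ^ 2 := by
    have h0 : 0 ≤ ∫ x, ‖f x‖ ^ 2 := by positivity
    rw [Lp.norm_toLp, hf.eLpNorm_eq_integral_rpow_norm two_ne_zero ENNReal.ofNat_ne_top,
      ENNReal.toReal_ofReal (by positivity)]
    simp only [ENNReal.toReal_ofNat, Real.rpow_ofNat]
    rw [← Real.rpow_natCast, ← Real.rpow_mul h0]
    simp
  have hF : (memLp_two_fourier h1 h2).toLp (𝓕 h) = 𝓕 (h2.toLp h) :=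
    Lp.ext ((MemLp.coeFn_toLp _).trans (coeFn_fourier_toLp_two h1 h2).symm)
  rw [norm_eq _ (memLp_two_fourier h1 h2), norm_eq _ h2, hF, Lp.norm_fourier_eq]

end Plancherel

section FractMellin

open MeasureTheory Set Filter Asymptotics Topology

/-- The fractional part, truncated to `(1, ∞)`. -/
noncomputable def tailFract : ℝ → ℝ := indicator (Ioi 1) Int.fract

theorem tailFract_nonneg (u : ℝ) : 0 ≤ tailFract u :=
  indicator_nonneg (fun _ _ ↦ Int.fract_nonneg _) u

theorem tailFract_le_one (u : ℝ) : tailFract u ≤ 1 :=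
  indicator_le' (fun _ _ ↦ (Int.fract_lt_one _).le) (fun _ _ ↦ zero_le_one) u

theorem tailFract_of_le_one {u : ℝ} (hu : u ≤ 1) : tailFract u = 0 :=
  indicator_of_notMem (notMem_Ioi.2 hu) _

theorem measurable_tailFract : Measurable tailFract :=
  measurable_fract.indicator measurableSet_Ioi

theorem locallyIntegrable_tailFract_inv :
    LocallyIntegrable fun u : ℝ ↦ (tailFract u⁻¹ : ℂ) := by
  refine (locallyIntegrable_const (1 : ℝ)).mono
    (measurable_tailFract.comp measurable_inv).complex_ofReal.aestronglyMeasurable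
    (Eventually.of_forall fun u ↦ ?_)
  simpa [abs_of_nonneg (tailFract_nonneg _)] using tailFract_le_one _

theorem tailFract_inv_isBigO_atTop (a : ℝ) :
    (fun u : ℝ ↦ (tailFract u⁻¹ : ℂ)) =O[atTop] (· ^ (-a)) := by
  refine (isBigO_zero _ _).congr' ?_ EventuallyEq.rfl
  filter_upwards [eventually_ge_atTop 1] with u hu
  simp [tailFract_of_le_one (inv_le_one_of_one_le₀ hu)]

theorem tailFract_inv_isBigO_zero :
    (fun u : ℝ ↦ (tailFract u⁻¹ : ℂ)) =O[𝓝[>] 0] (· ^ (-0 : ℝ)) := by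
  refine IsBigO.of_bound 1 (Eventually.of_forall fun u ↦ ?_)
  simpa [abs_of_nonneg (tailFract_nonneg _)] using tailFract_le_one _

theorem mellinConvergent_tailFract_inv {s : ℂ} (hs : 0 < s.re) :
    MellinConvergent (fun u : ℝ ↦ (tailFract u⁻¹ : ℂ)) s :=
  mellinConvergent_of_isBigO_rpow (locallyIntegrable_tailFract_inv.locallyIntegrableOn _)
    (tailFract_inv_isBigO_atTop (s.re + 1)) (lt_add_one _) tailFract_inv_isBigO_zero hs

theorem differentiableAt_mellin_tailFract_inv {s : ℂ} (hs : 0 < s.re) :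
    DifferentiableAt ℂ (mellin fun u : ℝ ↦ (tailFract u⁻¹ : ℂ)) s :=
  mellin_differentiableAt_of_isBigO_rpow (locallyIntegrable_tailFract_inv.locallyIntegrableOn _)
    (tailFract_inv_isBigO_atTop (s.re + 1)) (lt_add_one _) tailFract_inv_isBigO_zero hs

theorem mellin_tailFract_inv_eq_integral (s : ℂ) :
    mellin (fun u : ℝ ↦ (tailFract u⁻¹ : ℂ)) s =
      ∫ v in Ioi (1 : ℝ), ((Int.fract v : ℝ) : ℂ) * (v : ℂ) ^ (-(s + 1)) := by
  rw [mellin_comp_inv (fun u : ℝ ↦ (tailFract u : ℂ)), mellin]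
  have : ∀ v : ℝ, (v : ℂ) ^ (-s - 1) • (tailFract v : ℂ) =
      indicator (Ioi 1) (fun v : ℝ ↦ ((Int.fract v : ℝ) : ℂ) * (v : ℂ) ^ (-(s + 1))) v := by
    intro v
    by_cases hv : v ∈ Ioi (1 : ℝ)
    · simp only [tailFract, indicator_of_mem hv, smul_eq_mul]
      rw [mul_comm, neg_add']
    · simp [tailFract, indicator_of_notMem hv]
  simp_rw [this]
  rw [setIntegral_indicator measurableSet_Ioi,
    inter_eq_right.2 (Ioi_subset_Ioi zero_le_one)]

theorem integrableOn_fract_mul_cpow {s : ℂ} (hs : 0 < s.re) :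
    IntegrableOn (fun v : ℝ ↦ ((Int.fract v : ℝ) : ℂ) * (v : ℂ) ^ (-(s + 1))) (Ioi 1) := by
  refine Integrable.mono' (g := fun v : ℝ ↦ v ^ (-(s.re + 1)))
    (integrableOn_Ioi_rpow_of_lt (by linarith) one_pos) ?_ ?_
  · exact (measurable_fract.complex_ofReal.mul (by fun_prop)).aestronglyMeasurable
  · filter_upwards [ae_restrict_mem measurableSet_Ioi] with v hv
    have hv0 : (0 : ℝ) < v := one_pos.trans hv
    rw [norm_mul, norm_cpow_eq_rpow_re_of_pos hv0, norm_real,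
      Real.norm_of_nonneg (Int.fract_nonneg v)]
    simpa using mul_le_of_le_one_left (Real.rpow_nonneg hv0.le (-(s.re + 1)))
      (Int.fract_lt_one v).le

theorem riemannZeta_eq_sub_mellin_of_one_lt_re {s : ℂ} (hs : 1 < s.re) :
    riemannZeta s = s / (s - 1) - s * mellin (fun u : ℝ ↦ (tailFract u⁻¹ : ℂ)) s := by
  have hO : (fun n : ℕ ↦ ∑ k ∈ Finset.Icc 1 n, (1 : ℝ)) =O[atTop] fun n ↦ (n : ℝ) ^ (1 : ℝ) := by
    simpa using isBigO_refl _ _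
  have hL := LSeries_eq_mul_integral_of_nonneg (fun _ ↦ 1) zero_le_one hs hO
    (fun _ ↦ zero_le_one)
  have h1 : LSeries (fun _ ↦ ((1 : ℝ) : ℂ)) s = riemannZeta s := by
    rw [← LSeries_one_eq_riemannZeta hs]; simp [Pi.one_def]
  rw [h1] at hL
  have hcpow : IntegrableOn (fun v : ℝ ↦ (v : ℂ) ^ (-s)) (Ioi 1) :=
    integrableOn_Ioi_cpow_of_lt (by simpa using hs) one_pos
  have hint : ∫ v in Ioi (1 : ℝ), (v : ℂ) ^ (-s) = 1 / (s - 1) := by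
    rw [integral_Ioi_cpow_of_lt (by simpa using hs) one_pos, ofReal_one, one_cpow,
      show -s + 1 = -(s - 1) by ring, neg_div_neg_eq]
  rw [hL, mellin_tailFract_inv_eq_integral, div_eq_mul_one_div, ← mul_sub, ← hint,
    ← integral_sub hcpow (integrableOn_fract_mul_cpow (by linarith))]
  congr 1
  refine setIntegral_congr_fun measurableSet_Ioi fun v hv ↦ ?_
  have hv0 : (0 : ℝ) < v := one_pos.trans hv
  have hv' : (v : ℂ) ≠ 0 := by exact_mod_cast hv0.ne'
  have hfl : ((⌊v⌋₊ : ℝ) : ℂ) = v - Int.fract v := by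
    rw [← ofReal_sub, Int.self_sub_fract, natCast_floor_eq_intCast_floor hv0.le]
  have hpow : (v : ℂ) ^ (-s) = v * (v : ℂ) ^ (-(s + 1)) := by
    rw [show -s = 1 + -(s + 1) by ring, cpow_add _ _ hv', cpow_one]
  simp only [ofReal_one, Finset.sum_const, Nat.card_Icc, add_tsub_cancel_right, nsmul_eq_mul,
    mul_one]
  rw [hpow, ← sub_mul, ← hfl]
  simp

theorem riemannZeta_eq_sub_mellin {s : ℂ} (hs : 0 < s.re) (hs1 : s ≠ 1) :
    riemannZeta s = s / (s - 1) - s * mellin (fun u : ℝ ↦ (tailFract u⁻¹ : ℂ)) s := by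
  set M := mellin fun u : ℝ ↦ (tailFract u⁻¹ : ℂ) with hM
  have hopen : IsOpen {z : ℂ | 0 < z.re} := isOpen_lt continuous_const continuous_re
  have hZ : AnalyticOnNhd ℂ riemannZeta₁ {z : ℂ | 0 < z.re} :=
    differentiable_riemannZeta₁.differentiableOn.analyticOnNhd hopen
  have hR : AnalyticOnNhd ℂ (fun z ↦ z - z * (z - 1) * M z) {z : ℂ | 0 < z.re} := by
    refine DifferentiableOn.analyticOnNhd (fun z hz ↦ DifferentiableAt.differentiableWithinAt ?_)
      hopen
    have := differentiableAt_mellin_tailFract_inv hz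
    fun_prop
  have heq : EqOn riemannZeta₁ (fun z ↦ z - z * (z - 1) * M z) {z : ℂ | 0 < z.re} := by
    refine hZ.eqOn_of_preconnected_of_eventuallyEq hR
      (convex_halfSpace_re_gt 0).isPreconnected (z₀ := 2) (by simp) ?_
    filter_upwards [(isOpen_lt continuous_const continuous_re).mem_nhds
      (show (1 : ℝ) < (2 : ℂ).re by simp)] with z hz
    have hz1 : z ≠ 1 := by rintro rfl; simp at hz
    have hz1' : z - 1 ≠ 0 := sub_ne_zero.2 hz1
    have h := riemannZeta_eq_sub_mellin_of_one_lt_re hz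
    rw [riemannZeta_eq_inv_sub_mul hz1, ← hM] at h
    field_simp at h
    rw [h]; ring
  have hs1' : s - 1 ≠ 0 := sub_ne_zero.2 hs1
  rw [riemannZeta_eq_inv_sub_mul hs1, heq hs]
  field_simp

end FractMellin

section FractDifference

open MeasureTheory Set

theorem abs_tailFract_sub_le {u v : ℝ} (hu : 1 < u) (hvu : v ≤ u) :
    |tailFract u - tailFract v| ≤ (u - v) + (⌊u⌋ - ⌊v⌋) := by
  have hfl : (⌊v⌋ : ℝ) ≤ ⌊u⌋ := by exact_mod_cast Int.floor_mono hvu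
  have hu1 : (1 : ℝ) ≤ ⌊u⌋ := by exact_mod_cast Int.le_floor.2 (by simpa using hu.le)
  have hu2 : tailFract u = u - ⌊u⌋ := by
    simp [tailFract, indicator_of_mem (mem_Ioi.2 hu), Int.self_sub_floor]
  rw [hu2, abs_le]
  rcases lt_or_ge 1 v with hv | hv
  · have hv2 : tailFract v = v - ⌊v⌋ := by
      simp [tailFract, indicator_of_mem (mem_Ioi.2 hv), Int.self_sub_floor]
    rw [hv2]
    constructor <;> linarith
  · have hv2 : tailFract v = 0 := tailFract_of_le_one hv
    rw [hv2]
    constructor <;> linarith [Int.floor_le v, Int.floor_le u]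

/-- The ratio `⌊u⌋ / u` in the logarithmic variable `u = exp x`. -/
noncomputable def floorRatio (x : ℝ) : ℝ := Real.exp (-x) * ⌊Real.exp x⌋

theorem floorRatio_nonneg (x : ℝ) : 0 ≤ floorRatio x :=
  mul_nonneg (Real.exp_pos _).le (by exact_mod_cast Int.floor_nonneg.2 (Real.exp_pos x).le)

theorem floorRatio_le_one (x : ℝ) : floorRatio x ≤ 1 := by
  calc floorRatio x ≤ Real.exp (-x) * Real.exp x :=
        mul_le_mul_of_nonneg_left (Int.floor_le _) (Real.exp_pos _).le
    _ = 1 := by rw [← Real.exp_add]; simp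

theorem measurable_floorRatio : Measurable floorRatio := by
  unfold floorRatio; fun_prop

theorem intervalIntegrable_floorRatio (a b : ℝ) :
    IntervalIntegrable floorRatio volume a b := by
  refine (intervalIntegrable_const (c := (1 : ℝ))).mono_fun
    measurable_floorRatio.aestronglyMeasurable (Filter.Eventually.of_forall fun x ↦ ?_)
  simpa [abs_of_nonneg (floorRatio_nonneg x)] using floorRatio_le_one x

/-- The weighted difference of two dilates of `tailFract` in the logarithmic variable. -/
noncomputable def fractDiff (σ η x : ℝ) : ℝ :=
  Real.exp (-σ * x) * (tailFract (Real.exp x) - tailFract (Real.exp (x - η)))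

theorem measurable_fractDiff (σ η : ℝ) : Measurable (fractDiff σ η) :=
  (by fun_prop : Measurable fun x : ℝ ↦ Real.exp (-σ * x)).mul
    ((measurable_tailFract.comp Real.measurable_exp).sub
      (measurable_tailFract.comp (Real.measurable_exp.comp (measurable_id.sub_const η))))

theorem fractDiff_of_nonpos (σ : ℝ) {η x : ℝ} (hη : 0 ≤ η) (hx : x ≤ 0) :
    fractDiff σ η x = 0 := by
  have h1 : Real.exp x ≤ 1 := Real.exp_le_one_iff.2 hx
  have h2 : Real.exp (x - η) ≤ 1 := Real.exp_le_one_iff.2 (by linarith)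
  rw [fractDiff, tailFract_of_le_one h1, tailFract_of_le_one h2, sub_zero, mul_zero]

theorem abs_tailFract_sub_le_one (u v : ℝ) : |tailFract u - tailFract v| ≤ 1 :=
  abs_sub_le_iff.2 ⟨by linarith [tailFract_le_one u, tailFract_nonneg v],
    by linarith [tailFract_le_one v, tailFract_nonneg u]⟩

theorem abs_fractDiff_le {σ η x : ℝ} (hη : 0 ≤ η) :
    |fractDiff σ η x| ≤ indicator (Ioi 0) (fun x ↦ Real.exp (-σ * x)) x := by
  rcases le_or_gt x 0 with hx | hx
  · simp [fractDiff_of_nonpos σ hη hx, hx]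
  · rw [indicator_of_mem (mem_Ioi.2 hx), fractDiff, abs_mul, Real.abs_exp]
    exact mul_le_of_le_one_right (Real.exp_pos _).le (abs_tailFract_sub_le_one _ _)

theorem fractDiff_sq_le_abs_sub {σ η x : ℝ} (hσ : 1 / 2 ≤ σ) (hx : 0 ≤ x) :
    fractDiff σ η x ^ 2 ≤
      Real.exp (-x) * |tailFract (Real.exp x) - tailFract (Real.exp (x - η))| := by
  rw [fractDiff, mul_pow, ← sq_abs (tailFract _ - _), ← Real.exp_nat_mul]
  refine mul_le_mul (Real.exp_le_exp.2 ?_) ?_ (sq_nonneg _) (Real.exp_pos _).le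
  · push_cast; nlinarith
  · exact pow_le_of_le_one (abs_nonneg _) (abs_tailFract_sub_le_one _ _) two_ne_zero

theorem fractDiff_sq_le_exp {σ η x : ℝ} (hσ : 1 / 2 ≤ σ) (hx : 0 ≤ x) :
    fractDiff σ η x ^ 2 ≤ Real.exp (-x) :=
  (fractDiff_sq_le_abs_sub hσ hx).trans
    (mul_le_of_le_one_right (Real.exp_pos _).le (abs_tailFract_sub_le_one _ _))

theorem fractDiff_sq_le_floorRatio {σ η x : ℝ} (hσ : 1 / 2 ≤ σ) (hη : 0 ≤ η) (hx : 0 < x) :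
    fractDiff σ η x ^ 2 ≤
      (1 - Real.exp (-η)) + (floorRatio x - Real.exp (-η) * floorRatio (x - η)) := by
  refine (fractDiff_sq_le_abs_sub hσ hx.le).trans ?_
  have h := abs_tailFract_sub_le (Real.one_lt_exp_iff.2 hx)
    (Real.exp_le_exp.2 (show x - η ≤ x by linarith))
  refine (mul_le_mul_of_nonneg_left h (Real.exp_pos (-x)).le).trans_eq ?_
  have e1 : Real.exp (-x) * Real.exp x = 1 := by rw [← Real.exp_add]; simp
  have e2 : Real.exp (-x) * Real.exp (x - η) = Real.exp (-η) := by
    rw [← Real.exp_add]; congr 1; ring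
  have e3 : Real.exp (-η) * Real.exp (-(x - η)) = Real.exp (-x) := by
    rw [← Real.exp_add]; congr 1; ring
  unfold floorRatio
  rw [← mul_assoc (Real.exp (-η)), e3]
  linear_combination e1 - e2

theorem integral_floorRatio_bound_le {η X : ℝ} (hη : 0 ≤ η) (hX : 0 ≤ X) :
    ∫ x in (0 : ℝ)..X, ((1 - Real.exp (-η)) +
      (floorRatio x - Real.exp (-η) * floorRatio (x - η))) ≤ 2 * η * X + η := by
  have hi := intervalIntegrable_floorRatio
  have hshift : IntervalIntegrable (fun x ↦ floorRatio (x - η)) volume 0 X := by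
    simpa using (hi (0 - η) (X - η)).comp_sub_right η
  rw [intervalIntegral.integral_add (by simp) ((hi _ _).sub (hshift.const_mul _)),
    intervalIntegral.integral_sub (hi _ _) (hshift.const_mul _),
    intervalIntegral.integral_const_mul, intervalIntegral.integral_comp_sub_right,
    intervalIntegral.integral_const, sub_zero, smul_eq_mul]
  have hle {a b : ℝ} (hab : a ≤ b) : ∫ x in a..b, floorRatio x ≤ b - a := by
    simpa using intervalIntegral.integral_mono_on hab (hi a b) intervalIntegrable_const
      fun x _ ↦ floorRatio_le_one x
  have hge {a b : ℝ} (hab : a ≤ b) : 0 ≤ ∫ x in a..b, floorRatio x :=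
    intervalIntegral.integral_nonneg hab fun x _ ↦ floorRatio_nonneg x
  have hcomm := intervalIntegral.integral_interval_sub_interval_comm
    (hi 0 X) (hi (0 - η) (X - η)) (hi 0 (0 - η))
  rw [intervalIntegral.integral_symm (0 - η) 0, intervalIntegral.integral_symm (X - η) X] at hcomm
  have h1 := hle (show X - η ≤ X by linarith)
  have h2 := hge (show 0 - η ≤ 0 by linarith)
  have h3 := hle (show 0 - η ≤ X - η by linarith)
  have h4 := hge (show 0 - η ≤ X - η by linarith)
  have h5 : 1 - Real.exp (-η) ≤ η := by linarith [Real.add_one_le_exp (-η)]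
  have h6 : 0 ≤ 1 - Real.exp (-η) := by simpa using hη
  nlinarith

theorem integral_fractDiff_sq_le {σ η X : ℝ} (hσ : 1 / 2 ≤ σ) (hη : 0 ≤ η) (hX : 0 ≤ X) :
    ∫ x, fractDiff σ η x ^ 2 ≤ 2 * η * X + η + Real.exp (-X) := by
  set B : ℝ → ℝ := fun x ↦
    (1 - Real.exp (-η)) + (floorRatio x - Real.exp (-η) * floorRatio (x - η)) with hB
  have hBint : IntegrableOn B (Ioc 0 X) := by
    have hshift : IntervalIntegrable (fun x ↦ floorRatio (x - η)) volume 0 X := by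
      simpa using (intervalIntegrable_floorRatio (0 - η) (X - η)).comp_sub_right η
    rw [← intervalIntegrable_iff_integrableOn_Ioc_of_le hX]
    exact intervalIntegrable_const.add
      ((intervalIntegrable_floorRatio _ _).sub (hshift.const_mul _))
  have hEint : IntegrableOn (fun x : ℝ ↦ Real.exp (-x)) (Ioi X) := integrableOn_exp_neg_Ioi X
  calc ∫ x, fractDiff σ η x ^ 2
      ≤ ∫ x, (indicator (Ioc 0 X) B x + indicator (Ioi X) (fun x ↦ Real.exp (-x)) x) := by
        refine integral_mono_of_nonneg (Filter.Eventually.of_forall fun x ↦ sq_nonneg _)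
          ((hBint.integrable_indicator measurableSet_Ioc).add
            (hEint.integrable_indicator measurableSet_Ioi))
          (Filter.Eventually.of_forall fun x ↦ ?_)
        dsimp only
        rcases le_or_gt x 0 with hx | hx
        · simp [fractDiff_of_nonpos σ hη hx, hx, hx.trans hX]
        · rcases le_or_gt x X with hxX | hxX
          · simpa [hx, hxX] using fractDiff_sq_le_floorRatio hσ hη hx
          · simpa [hxX, not_le.2 hxX] using fractDiff_sq_le_exp hσ hx.le
    _ = (∫ x in (0 : ℝ)..X, B x) + Real.exp (-X) := by
        rw [integral_add (hBint.integrable_indicator measurableSet_Ioc)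
          (hEint.integrable_indicator measurableSet_Ioi), integral_indicator measurableSet_Ioc,
          integral_indicator measurableSet_Ioi, integral_exp_neg_Ioi,
          intervalIntegral.integral_of_le hX]
    _ ≤ _ := by
        gcongr
        exact integral_floorRatio_bound_le hη hX

theorem integrable_fractDiff {σ η : ℝ} (hσ : 0 < σ) (hη : 0 ≤ η) :
    Integrable (fractDiff σ η) :=
  Integrable.mono' ((integrableOn_exp_mul_Ioi (neg_neg_of_pos hσ) 0).integrable_indicator
      measurableSet_Ioi) (measurable_fractDiff σ η).aestronglyMeasurable
    (Filter.Eventually.of_forall fun _ ↦ abs_fractDiff_le hη)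

theorem memLp_two_fractDiff {σ η : ℝ} (hσ : 0 < σ) (hη : 0 ≤ η) :
    MemLp (fractDiff σ η) 2 := by
  refine (memLp_two_iff_integrable_sq (measurable_fractDiff σ η).aestronglyMeasurable).2 ?_
  refine (integrable_fractDiff hσ hη).norm.mono'
    ((measurable_fractDiff σ η).pow_const 2).aestronglyMeasurable
    (Filter.Eventually.of_forall fun x ↦ ?_)
  have h1 : |fractDiff σ η x| ≤ 1 := by
    refine (abs_fractDiff_le hη).trans (indicator_le' (fun x hx ↦ ?_) (fun _ _ ↦ zero_le_one) x)
    exact Real.exp_le_one_iff.2 (by nlinarith [mem_Ioi.1 hx])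
  rw [norm_pow]
  exact pow_le_of_le_one (norm_nonneg _) h1 two_ne_zero

end FractDifference

section SecondMoment

open MeasureTheory Set FourierTransform

theorem mellin_mul_eq_fourier_fractDiff {σ : ℝ} (hσ : 0 < σ) (η t : ℝ) :
    (1 - exp (-(η * (σ + t * I)))) * mellin (fun u : ℝ ↦ (tailFract u⁻¹ : ℂ)) (σ + t * I) =
      𝓕 (fun x ↦ (fractDiff σ η x : ℂ)) (t / (2 * Real.pi)) := by
  set s : ℂ := σ + t * I with hs
  have hre : s.re = σ := by simp [hs]
  have him : s.im = t := by simp [hs]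
  set f : ℝ → ℂ := fun u ↦ (tailFract u⁻¹ : ℂ) with hf
  have hconv : MellinConvergent f s := mellinConvergent_tailFract_inv (by rwa [hre])
  have hpos := Real.exp_pos η
  have hpow : ((Real.exp η : ℝ) : ℂ) ^ (-s) = exp (-(η * s)) := by
    rw [cpow_def_of_ne_zero (by exact_mod_cast hpos.ne'), ← ofReal_log hpos.le, Real.log_exp]
    congr 1; ring
  have hdiff := (hasMellin_sub hconv ((MellinConvergent.comp_mul_left hpos).2 hconv)).2
  rw [mellin_comp_mul_left f s hpos, hpow, smul_eq_mul] at hdiff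
  rw [sub_mul, one_mul, ← hdiff, mellin_eq_fourier, hre, him]
  refine congrArg (fun g : ℝ → ℂ ↦ 𝓕 g (t / (2 * Real.pi))) (funext fun x ↦ ?_)
  have h1 : (Real.exp η * Real.exp (-x))⁻¹ = Real.exp (x - η) := by
    rw [← Real.exp_add, ← Real.exp_neg]; congr 1; ring
  have h2 : (Real.exp (-x))⁻¹ = Real.exp x := by rw [← Real.exp_neg, neg_neg]
  simp only [hf, fractDiff, h1, h2, real_smul]
  push_cast
  ring

theorem one_le_eight_mul_norm_one_sub_exp {η σ t : ℝ} (hη : 0 ≤ η) (hη1 : η ≤ 1) (hσ : σ ≤ 1)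
    (h1 : 1 / 2 ≤ η * t) (h2 : η * t ≤ 1) :
    1 ≤ 8 * ‖1 - exp (-(η * (σ + t * I)))‖ := by
  have him : (1 - exp (-(η * (σ + t * I)))).im = Real.exp (-(η * σ)) * Real.sin (η * t) := by
    rw [sub_im, exp_im]
    simp [Real.sin_neg]
  have hsin : 3 / 8 < Real.sin (η * t) := by
    have := Real.sin_gt_sub_cube (show 0 < η * t by linarith)
    nlinarith [mul_nonneg (sub_nonneg.2 h1) (sub_nonneg.2 h2), sq_nonneg (η * t)]
  have hexp : 1 / 3 ≤ Real.exp (-(η * σ)) := by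
    have h3 : Real.exp (-1) ≤ Real.exp (-(η * σ)) := Real.exp_le_exp.2 (by nlinarith)
    refine le_trans ?_ h3
    rw [Real.exp_neg, one_div]
    exact inv_anti₀ (Real.exp_pos 1) (by linarith [Real.exp_one_lt_d9])
  have := (le_abs_self _).trans (abs_im_le_norm (1 - exp (-(η * (σ + t * I)))))
  rw [him] at this
  nlinarith

theorem integral_norm_sq_mellin_le {σ T : ℝ} (hσ : 1 / 2 ≤ σ) (hσ1 : σ ≤ 1) (hT : 1 ≤ T) :
    IntervalIntegrable
      (fun t : ℝ ↦ ‖mellin (fun u : ℝ ↦ (tailFract u⁻¹ : ℂ)) (σ + t * I)‖ ^ 2) volume T (2 * T) ∧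
    ∫ t in T..(2 * T), ‖mellin (fun u : ℝ ↦ (tailFract u⁻¹ : ℂ)) (σ + t * I)‖ ^ 2 ≤
      128 * Real.pi * ((Real.log (2 * T) + 1) / T) := by
  have hT0 : 0 < T := by linarith
  have hσ0 : 0 < σ := by linarith
  set M := mellin fun u : ℝ ↦ (tailFract u⁻¹ : ℂ) with hM
  set η : ℝ := (2 * T)⁻¹ with hη
  have hη0 : 0 ≤ η := by positivity
  have hη1 : η ≤ 1 := inv_le_one_of_one_le₀ (by linarith)
  set h : ℝ → ℂ := fun x ↦ (fractDiff σ η x : ℂ) with hh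
  have hL1 : Integrable h := (integrable_fractDiff hσ0 hη0).ofReal
  have hL2 : MemLp h 2 := (memLp_two_fractDiff hσ0 hη0).ofReal
  have hpi : 0 < 2 * Real.pi := by positivity
  have hFint : Integrable fun t : ℝ ↦ ‖𝓕 h (t / (2 * Real.pi))‖ ^ 2 :=
    ((memLp_two_fourier hL1 hL2).integrable_norm_pow two_ne_zero).comp_div hpi.ne'
  have hMcont : Continuous fun t : ℝ ↦ M (σ + t * I) := by
    refine continuous_iff_continuousAt.2 fun t ↦ ?_
    have := (differentiableAt_mellin_tailFract_inv
      (show 0 < ((σ : ℂ) + t * I).re by simpa)).continuousAt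
    exact ContinuousAt.comp (f := fun t : ℝ ↦ (σ : ℂ) + t * I) this (by fun_prop)
  have hMint : IntervalIntegrable (fun t : ℝ ↦ ‖M (σ + t * I)‖ ^ 2) volume T (2 * T) :=
    (hMcont.norm.pow 2).intervalIntegrable _ _
  refine ⟨hMint, ?_⟩
  have hpt : ∀ t ∈ Icc T (2 * T),
      ‖M (σ + t * I)‖ ^ 2 ≤ 64 * ‖𝓕 h (t / (2 * Real.pi))‖ ^ 2 := by
    intro t ht
    have h1 : 1 / 2 ≤ η * t := by
      rw [hη, inv_mul_eq_div, div_le_div_iff₀ two_pos (by positivity)]; linarith [ht.1]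
    have h2 : η * t ≤ 1 := by
      rw [hη, inv_mul_eq_div, div_le_one (by positivity)]; exact ht.2
    have h3 := one_le_eight_mul_norm_one_sub_exp hη0 hη1 hσ1 h1 h2
    rw [← mellin_mul_eq_fourier_fractDiff hσ0 η t, norm_mul, ← hM]
    have h4 := mul_le_mul_of_nonneg_right h3 (norm_nonneg (M (σ + t * I)))
    rw [one_mul] at h4
    calc ‖M (σ + t * I)‖ ^ 2
        ≤ (8 * ‖1 - exp (-(η * (σ + t * I)))‖ * ‖M (σ + t * I)‖) ^ 2 := by gcongr
      _ = _ := by ring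
  have hX : 0 ≤ Real.log (2 * T) := Real.log_nonneg (by linarith)
  calc ∫ t in T..(2 * T), ‖M (σ + t * I)‖ ^ 2
      ≤ ∫ t in T..(2 * T), 64 * ‖𝓕 h (t / (2 * Real.pi))‖ ^ 2 :=
        intervalIntegral.integral_mono_on (by linarith) hMint
          (hFint.const_mul 64).intervalIntegrable hpt
    _ ≤ ∫ t : ℝ, 64 * ‖𝓕 h (t / (2 * Real.pi))‖ ^ 2 := by
        rw [intervalIntegral.integral_of_le (by linarith)]
        exact setIntegral_le_integral (hFint.const_mul 64)
          (Filter.Eventually.of_forall fun t ↦ by positivity)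
    _ = 128 * Real.pi * ∫ x, fractDiff σ η x ^ 2 := by
        rw [integral_const_mul,
          Measure.integral_comp_div (fun ξ ↦ ‖𝓕 h ξ‖ ^ 2), integral_norm_sq_fourier hL1 hL2,
          abs_of_pos hpi, smul_eq_mul]
        simp only [hh, norm_real, Real.norm_eq_abs, sq_abs]
        ring
    _ ≤ 128 * Real.pi * (2 * η * Real.log (2 * T) + η + Real.exp (-Real.log (2 * T))) := by
        gcongr
        exact integral_fractDiff_sq_le hσ hη0 hX
    _ = 128 * Real.pi * ((Real.log (2 * T) + 1) / T) := by
        rw [Real.exp_neg, Real.exp_log (by positivity), hη]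
        field_simp
        ring

theorem norm_riemannZeta_sq_le {σ t T : ℝ} (hσ : 0 < σ) (hσ1 : σ ≤ 1) (hT : 1 ≤ T)
    (h1 : T ≤ t) (h2 : t ≤ 2 * T) :
    ‖riemannZeta (σ + t * I)‖ ^ 2 ≤
      8 + 18 * T ^ 2 * ‖mellin (fun u : ℝ ↦ (tailFract u⁻¹ : ℂ)) (σ + t * I)‖ ^ 2 := by
  set s : ℂ := σ + t * I with hs
  have hre : s.re = σ := by simp [hs]
  have him : s.im = t := by simp [hs]
  have hs1 : 1 ≤ ‖s - 1‖ := by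
    have := (le_abs_self _).trans (abs_im_le_norm (s - 1))
    rw [sub_im, him, one_im, sub_zero] at this
    linarith
  have hne : s - 1 ≠ 0 := norm_pos_iff.1 (by linarith)
  have hdiv : ‖s / (s - 1)‖ ≤ 2 := by
    rw [show s / (s - 1) = 1 + (s - 1)⁻¹ by field_simp; ring]
    refine (norm_add_le _ _).trans ?_
    rw [norm_one, norm_inv]
    linarith [inv_le_one_of_one_le₀ hs1]
  have hsT : ‖s‖ ≤ 3 * T := by
    refine (norm_le_abs_re_add_abs_im s).trans ?_
    rw [hre, him, abs_of_pos hσ, abs_of_nonneg (by linarith)]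
    linarith
  rw [riemannZeta_eq_sub_mellin (by rwa [hre]) (sub_ne_zero.1 hne)]
  set m := mellin (fun u : ℝ ↦ (tailFract u⁻¹ : ℂ)) s
  have hb : ‖s / (s - 1) - s * m‖ ≤ 2 + 3 * T * ‖m‖ := by
    refine (norm_sub_le _ _).trans ?_
    rw [norm_mul]
    gcongr
  calc ‖s / (s - 1) - s * m‖ ^ 2 ≤ (2 + 3 * T * ‖m‖) ^ 2 := by gcongr
    _ ≤ 8 + 18 * T ^ 2 * ‖m‖ ^ 2 := by nlinarith [sq_nonneg (2 - 3 * T * ‖m‖)]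

theorem integral_norm_sq_riemannZeta_le {σ T : ℝ} (hσ : 1 / 2 ≤ σ) (hσ1 : σ ≤ 1) (hT : 1 ≤ T) :
    ∫ t in T..(2 * T), ‖riemannZeta (σ + t * I)‖ ^ 2 ≤
      (8 + 2304 * Real.pi * (Real.log (2 * T) + 1)) * T := by
  have hT0 : 0 < T := by linarith
  obtain ⟨hMint, hM⟩ := integral_norm_sq_mellin_le hσ hσ1 hT
  have hz : ContinuousOn (fun t : ℝ ↦ ‖riemannZeta (σ + t * I)‖ ^ 2) (uIcc T (2 * T)) := by
    rw [uIcc_of_le (by linarith)]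
    intro t ht
    have hne : (σ : ℂ) + t * I ≠ 1 := by
      intro h
      have := congrArg Complex.im h
      simp at this
      linarith [ht.1]
    have := (differentiableAt_riemannZeta hne).continuousAt
    exact ((ContinuousAt.comp (f := fun t : ℝ ↦ (σ : ℂ) + t * I) this
      (by fun_prop)).norm.pow 2).continuousWithinAt
  refine (intervalIntegral.integral_mono_on (by linarith) hz.intervalIntegrable
    (intervalIntegrable_const.add (hMint.const_mul (18 * T ^ 2)))
    fun t ht ↦ norm_riemannZeta_sq_le (by linarith) hσ1 hT ht.1 ht.2).trans ?_
  rw [intervalIntegral.integral_add intervalIntegrable_const (hMint.const_mul _),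
    intervalIntegral.integral_const, intervalIntegral.integral_const_mul, smul_eq_mul]
  calc (2 * T - T) * 8 + 18 * T ^ 2 * _
      ≤ (2 * T - T) * 8 + 18 * T ^ 2 * (128 * Real.pi * ((Real.log (2 * T) + 1) / T)) := by gcongr
    _ = _ := by field_simp; ring

end SecondMoment

theorem stmt8 (ε : ℝ) (hε : 0 < ε) :
    ∃ C : ℝ, 0 < C ∧ ∀ σ : ℝ, 1 / 2 ≤ σ → σ ≤ 1 → ∀ T : ℝ, 1 ≤ T →
      (∫ t in T..(2 * T), ‖riemannZeta (↑σ + ↑t * I)‖ ^ 2) ≤ C * T ^ (1 + ε) := by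
  have hpi := Real.pi_pos
  refine ⟨8 + 2304 * Real.pi * (2 + 1 / ε), by positivity, fun σ hσ hσ1 T hT ↦ ?_⟩
  have hT0 : 0 < T := by linarith
  refine (integral_norm_sq_riemannZeta_le hσ hσ1 hT).trans ?_
  rw [Real.rpow_add hT0, Real.rpow_one, mul_comm T, ← mul_assoc]
  gcongr
  have h1 : 1 ≤ T ^ ε := Real.one_le_rpow hT hε.le
  have h2 : Real.log (2 * T) + 1 ≤ (2 + 1 / ε) * T ^ ε := by
    rw [Real.log_mul two_ne_zero hT0.ne']
    have := Real.log_le_rpow_div hT0.le hε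
    rw [add_mul, one_div_mul_eq_div]
    linarith [Real.log_two_lt_d9]
  nlinarith [mul_le_mul_of_nonneg_left h2 (show 0 ≤ 2304 * Real.pi by positivity)]
end
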